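/- Let γ be a queenon and N ∈ ℕ. Then the function G^N is concave on the convex set BW of BW-decompositions; G^N(γ/2, γ/2) = H_q^N(γ); and for every BW-decomposition (γ_b, γ_w) of γ, G^N(γ_b, γ_w) ≤ G^N(γ/2, γ/2) = H_q^N(γ). -/

import Mathlib

open MeasureTheory Filter Topology
open scoped ENNReal

noncomputable section

/-- The square `[-1/2,1/2]²`. -/
def unitSq : Set (ℝ × ℝ) :=
  Set.Icc (-(1:ℝ)/2) (1/2) ×ˢ Set.Icc (-(1:ℝ)/2) (1/2)

/-- The square `σ_{i,j}^N` (for `i, j ∈ [N]`). -/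
def gridSq (N i j : ℕ) : Set (ℝ × ℝ) :=
  Set.Icc (-(1:ℝ)/2 + ((i:ℝ) - 1)/N) (-(1:ℝ)/2 + (i:ℝ)/N) ×ˢ
    Set.Icc (-(1:ℝ)/2 + ((j:ℝ) - 1)/N) (-(1:ℝ)/2 + (j:ℝ)/N)

/-- The cell of the partition `I_N` with index `i, j ∈ [2N]`. -/
def INcell (N i j : ℕ) : Set (ℝ × ℝ) :=
  {p ∈ unitSq | (-1 + ((i:ℝ) - 1)/N ≤ p.1 + p.2 ∧ p.1 + p.2 ≤ -1 + (i:ℝ)/N) ∧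
    (-1 + ((j:ℝ) - 1)/N ≤ p.2 - p.1 ∧ p.2 - p.1 ≤ -1 + (j:ℝ)/N)}

/-- The interval of the partition `J_N` of `[-1,1]` with index `i ∈ [2N]`. -/
def JNcell (N i : ℕ) : Set ℝ :=
  Set.Icc (-1 + ((i:ℝ) - 1)/N) (-1 + (i:ℝ)/N)

/-- A member of the family `R` of subsets of the square. -/
def Rset (a₁ b₁ a₂ b₂ : ℝ) : Set (ℝ × ℝ) :=
  {p ∈ unitSq | (a₁ ≤ p.1 + p.2 ∧ p.1 + p.2 ≤ b₁) ∧ (a₂ ≤ p.2 - p.1 ∧ p.2 - p.1 ≤ b₂)}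

/-- The distance `d` between two Borel measures on the square: the supremum of
`|γ₁(α) − γ₂(α)|` over `α ∈ R`. -/
def qdist (μ ν : Measure (ℝ × ℝ)) : ℝ :=
  sSup {t : ℝ | ∃ a₁ b₁ a₂ b₂ : ℝ, a₁ ∈ Set.Icc (-1:ℝ) 1 ∧ b₁ ∈ Set.Icc (-1:ℝ) 1 ∧
    a₂ ∈ Set.Icc (-1:ℝ) 1 ∧ b₂ ∈ Set.Icc (-1:ℝ) 1 ∧
    t = |(μ (Rset a₁ b₁ a₂ b₂)).toReal - (ν (Rset a₁ b₁ a₂ b₂)).toReal|}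

/-- A permuton: a Borel probability measure on the square with uniform marginals. -/
def IsPermuton (μ : Measure (ℝ × ℝ)) : Prop :=
  IsProbabilityMeasure μ ∧ μ unitSqᶜ = 0 ∧
  ∀ a b : ℝ, -(1:ℝ)/2 ≤ a → a ≤ b → b ≤ 1/2 →
    μ (Set.Icc a b ×ˢ Set.Icc (-(1:ℝ)/2) (1/2)) = ENNReal.ofReal (b - a) ∧
    μ (Set.Icc (-(1:ℝ)/2) (1/2) ×ˢ Set.Icc a b) = ENNReal.ofReal (b - a)

/-- An `N`-step permuton: a permuton with constant density on each square `σ_{i,j}^N`. -/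
def IsStepPermutonN (N : ℕ) (μ : Measure (ℝ × ℝ)) : Prop :=
  IsPermuton μ ∧
  ∀ i ∈ Finset.Icc 1 N, ∀ j ∈ Finset.Icc 1 N, ∃ c : ℝ≥0∞,
    ∀ s : Set (ℝ × ℝ), s ⊆ gridSq N i j → MeasurableSet s → μ s = c * volume s

/-- A step permuton. -/
def IsStepPermuton (μ : Measure (ℝ × ℝ)) : Prop :=
  ∃ N : ℕ, 0 < N ∧ IsStepPermutonN N μ

/-- Sub-uniform diagonal marginals. -/
def SubUniformDiag (μ : Measure (ℝ × ℝ)) : Prop :=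
  ∀ a b : ℝ, -1 ≤ a → a ≤ b → b ≤ 1 →
    μ {p ∈ unitSq | a ≤ p.1 + p.2 ∧ p.1 + p.2 ≤ b} ≤ ENNReal.ofReal (b - a) ∧
    μ {p ∈ unitSq | a ≤ p.2 - p.1 ∧ p.2 - p.1 ≤ b} ≤ ENNReal.ofReal (b - a)

/-- The set `Γ` of queenons: the closure, in the topology of weak convergence of Borel
probability measures, of the set of step permutons with sub-uniform diagonal marginals. -/
def queenons : Set (ProbabilityMeasure (ℝ × ℝ)) :=
  closure {μ : ProbabilityMeasure (ℝ × ℝ) |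
    IsStepPermuton μ.toMeasure ∧ SubUniformDiag μ.toMeasure}

/-- The pushforward `γ⁺` of `γ` under `(x,y) ↦ x+y`. -/
def diagPlus (γ : Measure (ℝ × ℝ)) : Measure ℝ := γ.map fun p => p.1 + p.2

/-- The pushforward `γ⁻` of `γ` under `(x,y) ↦ y−x`. -/
def diagMinus (γ : Measure (ℝ × ℝ)) : Measure ℝ := γ.map fun p => p.2 - p.1

/-- The measure `γ̄⁺` on `[-1,1]`, with `γ̄⁺([a,b]) = (b−a) − γ⁺([a,b])`. -/
def barPlus (γ : Measure (ℝ × ℝ)) : Measure ℝ :=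
  volume.restrict (Set.Icc (-1:ℝ) 1) - diagPlus γ

/-- The measure `γ̄⁻` on `[-1,1]`, with `γ̄⁻([a,b]) = (b−a) − γ⁻([a,b])`. -/
def barMinus (γ : Measure (ℝ × ℝ)) : Measure ℝ :=
  volume.restrict (Set.Icc (-1:ℝ) 1) - diagMinus γ

/-- The uniform probability measure on `[-1,1]` (density `1/2`). -/
def unif11 : Measure ℝ := (2 : ℝ≥0∞)⁻¹ • volume.restrict (Set.Icc (-1:ℝ) 1)

open Classical in
/-- The Kullback–Leibler divergence of `μ` with respect to `ν`, as an extended real: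
`∫ log (dμ/dν) dμ` if `μ ≪ ν` and the integrand is integrable, and `+∞` otherwise. -/
def DKL {X : Type*} [MeasurableSpace X] (μ ν : Measure X) : EReal :=
  if μ ≪ ν ∧ Integrable (fun x => Real.log (μ.rnDeriv ν x).toReal) μ then
    ((∫ x, Real.log (μ.rnDeriv ν x).toReal ∂μ : ℝ) : EReal)
  else ⊤

/-- The Q-entropy `H_q(γ) = −D_KL(γ) − D_KL(γ̄⁺) − D_KL(γ̄⁻) + 2 log 2 − 3`. -/
def Hq (γ : Measure (ℝ × ℝ)) : EReal :=
  -DKL γ (volume.restrict unitSq) - DKL (barPlus γ) unif11 - DKL (barMinus γ) unif11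
    + ((2 * Real.log 2 - 3 : ℝ) : EReal)

/-- The discrete approximation `H_q^N` of the Q-entropy. -/
def HqN (N : ℕ) (γ : Measure (ℝ × ℝ)) : ℝ :=
  -(∑ i ∈ Finset.Icc 1 (2*N), ∑ j ∈ Finset.Icc 1 (2*N),
      (γ (INcell N i j)).toReal *
        Real.log ((γ (INcell N i j)).toReal / (volume (INcell N i j)).toReal))
  - (∑ i ∈ Finset.Icc 1 (2*N),
      (barPlus γ (JNcell N i)).toReal *
        Real.log ((2*N : ℝ) * (barPlus γ (JNcell N i)).toReal))
  - (∑ i ∈ Finset.Icc 1 (2*N),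
      (barMinus γ (JNcell N i)).toReal *
        Real.log ((2*N : ℝ) * (barMinus γ (JNcell N i)).toReal))
  + 2 * Real.log 2 - 3

/-- An `n`-queens configuration: a subset of `[n]² = {1,…,n}²` with exactly one element in
each row and column and at most one element in each plus- and minus-diagonal. -/
def IsQueensConfig (n : ℕ) (q : Finset (ℕ × ℕ)) : Prop :=
  (∀ p ∈ q, p.1 ∈ Finset.Icc 1 n ∧ p.2 ∈ Finset.Icc 1 n) ∧
  (∀ y ∈ Finset.Icc 1 n, ∃! x : ℕ, (x, y) ∈ q) ∧
  (∀ x ∈ Finset.Icc 1 n, ∃! y : ℕ, (x, y) ∈ q) ∧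
  (∀ p ∈ q, ∀ p' ∈ q, p.1 + p.2 = p'.1 + p'.2 → p = p') ∧
  (∀ p ∈ q, ∀ p' ∈ q, (p.2 : ℤ) - (p.1 : ℤ) = (p'.2 : ℤ) - (p'.1 : ℤ) → p = p')

/-- `Q(n)`, the number of `n`-queens configurations. -/
def numQueens (n : ℕ) : ℕ :=
  Set.ncard {q : Finset (ℕ × ℕ) | IsQueensConfig n q}

/-- The measure `γ_q` associated to an `n`-queens configuration `q`: density `n` on each
square `σ_{i,j}^n` with `(i,j) ∈ q`, and `0` elsewhere. -/
def gammaOf (n : ℕ) (q : Finset (ℕ × ℕ)) : Measure (ℝ × ℝ) :=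
  volume.withDensity ((⋃ ij ∈ q, gridSq n ij.1 ij.2).indicator fun _ => (n : ℝ≥0∞))

/-- The set `B_n(γ,ε)` of `n`-queens configurations `q` with `d(γ_q, γ) < ε`. -/
def Bset (n : ℕ) (γ : Measure (ℝ × ℝ)) (ε : ℝ) : Set (Finset (ℕ × ℕ)) :=
  {q | IsQueensConfig n q ∧ qdist (gammaOf n q) γ < ε}

/-- `|B_n(γ,ε)|`. -/
def Bcard (n : ℕ) (γ : Measure (ℝ × ℝ)) (ε : ℝ) : ℕ := (Bset n γ ε).ncard

/-- The exponential of an extended real, with `exp(−∞) = 0`. -/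
def expEReal (x : EReal) : ℝ := if x = ⊥ then 0 else Real.exp x.toReal

/-- `(γb, γw)` is a BW-decomposition of `γ`. -/
def IsBWDecomp (γ γb γw : Measure (ℝ × ℝ)) : Prop :=
  γb + γw = γ ∧
  ∀ a b : ℝ, -1 ≤ a → a ≤ b → b ≤ 1 →
    (γb {p : ℝ × ℝ | a ≤ p.1 + p.2 ∧ p.1 + p.2 ≤ b} ≤ ENNReal.ofReal ((b - a)/2) ∧
     γb {p : ℝ × ℝ | a ≤ p.1 - p.2 ∧ p.1 - p.2 ≤ b} ≤ ENNReal.ofReal ((b - a)/2)) ∧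
    (γw {p : ℝ × ℝ | a ≤ p.1 + p.2 ∧ p.1 + p.2 ≤ b} ≤ ENNReal.ofReal ((b - a)/2) ∧
     γw {p : ℝ × ℝ | a ≤ p.1 - p.2 ∧ p.1 - p.2 ≤ b} ≤ ENNReal.ofReal ((b - a)/2))

/-- `(γb, γw)` belongs to `BW`: it is a BW-decomposition of some queenon. -/
def memBW (γb γw : Measure (ℝ × ℝ)) : Prop :=
  ∃ γ : ProbabilityMeasure (ℝ × ℝ), γ ∈ queenons ∧ IsBWDecomp γ.toMeasure γb γw

/-- The measure `γ̄_i⁺` on `[-1,1]`, with `γ̄_i⁺([a,b]) = (b−a)/2 − γ_i⁺([a,b])`,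
where `γ_i⁺` is the pushforward of `γ_i` under `(x,y) ↦ x+y`. -/
def bwBarPlus (γi : Measure (ℝ × ℝ)) : Measure ℝ :=
  (2 : ℝ≥0∞)⁻¹ • volume.restrict (Set.Icc (-1:ℝ) 1) - γi.map fun p => p.1 + p.2

/-- The measure `γ̄_i⁻` on `[-1,1]`, with `γ̄_i⁻([a,b]) = (b−a)/2 − γ_i⁻([a,b])`,
where `γ_i⁻` is the pushforward of `γ_i` under `(x,y) ↦ x−y`. -/
def bwBarMinus (γi : Measure (ℝ × ℝ)) : Measure ℝ :=
  (2 : ℝ≥0∞)⁻¹ • volume.restrict (Set.Icc (-1:ℝ) 1) - γi.map fun p => p.1 - p.2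

/-- The function `G^N` on BW-decompositions. -/
def GN (N : ℕ) (γb γw : Measure (ℝ × ℝ)) : ℝ :=
  -(∑ i ∈ Finset.Icc 1 (2*N), ∑ j ∈ Finset.Icc 1 (2*N),
      ((γb (INcell N i j)).toReal *
          Real.log (2 * (γb (INcell N i j)).toReal / (volume (INcell N i j)).toReal) +
        (γw (INcell N i j)).toReal *
          Real.log (2 * (γw (INcell N i j)).toReal / (volume (INcell N i j)).toReal)))
  - (∑ i ∈ Finset.Icc 1 (2*N),
      ((bwBarPlus γb (JNcell N i)).toReal *
          Real.log ((4*N : ℝ) * (bwBarPlus γb (JNcell N i)).toReal) +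
        (bwBarPlus γw (JNcell N i)).toReal *
          Real.log ((4*N : ℝ) * (bwBarPlus γw (JNcell N i)).toReal)))
  - (∑ i ∈ Finset.Icc 1 (2*N),
      ((bwBarMinus γb (JNcell N i)).toReal *
          Real.log ((4*N : ℝ) * (bwBarMinus γb (JNcell N i)).toReal) +
        (bwBarMinus γw (JNcell N i)).toReal *
          Real.log ((4*N : ℝ) * (bwBarMinus γw (JNcell N i)).toReal)))
  + 2 * Real.log 2 - 3

/-- The measure `γ_{q,b}` of the black queens of `q` (positions `(x,y)` with `x+y` even). -/
def gammaBlack (n : ℕ) (q : Finset (ℕ × ℕ)) : Measure (ℝ × ℝ) :=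
  volume.withDensity
    ((⋃ ij ∈ q.filter (fun ij => (ij.1 + ij.2) % 2 = 0), gridSq n ij.1 ij.2).indicator
      fun _ => (n : ℝ≥0∞))

/-- The measure `γ_{q,w}` of the white queens of `q` (positions `(x,y)` with `x+y` odd). -/
def gammaWhite (n : ℕ) (q : Finset (ℕ × ℕ)) : Measure (ℝ × ℝ) :=
  volume.withDensity
    ((⋃ ij ∈ q.filter (fun ij => (ij.1 + ij.2) % 2 = 1), gridSq n ij.1 ij.2).indicator
      fun _ => (n : ℝ≥0∞))

/-- The set `B_n((γb,γw), ε)` of `n`-queens configurations `q` with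
`d_BW((γ_{q,b}, γ_{q,w}), (γb, γw)) < ε`. -/
def BsetBW (n : ℕ) (γb γw : Measure (ℝ × ℝ)) (ε : ℝ) : Set (Finset (ℕ × ℕ)) :=
  {q | IsQueensConfig n q ∧
    max (qdist (gammaBlack n q) γb) (qdist (gammaWhite n q) γw) < ε}

theorem le_volume_of_Ioc_le {ν : Measure ℝ}
    (h : ∀ a b : ℝ, ν (Set.Ioc a b) ≤ ENNReal.ofReal (b - a)) : ν ≤ volume := by
  have key : ν.toOuterMeasure ≤ StieltjesFunction.id.outer := by
    refine OuterMeasure.le_ofFunction.2 fun s => ?_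
    rw [StieltjesFunction.length_eq]
    refine le_iInf fun a => le_iInf fun b => le_iInf fun hab => ?_
    have hbot : (botSet : Set ℝ) = ∅ := by
      ext x
      simp [botSet]
    rw [hbot, Set.sdiff_empty] at hab
    exact (measure_mono hab).trans (h a b)
  rw [Real.volume_eq_stieltjes_id, StieltjesFunction.measure]
  exact Measure.toOuterMeasure_le.1 key

theorem le_volume_restrict_of_Icc_le {ν : Measure ℝ} {l u : ℝ}
    (hν : ν (Set.Icc l u)ᶜ = 0)
    (h : ∀ a b : ℝ, l ≤ a → a ≤ b → b ≤ u → ν (Set.Icc a b) ≤ ENNReal.ofReal (b - a)) :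
    ν ≤ volume.restrict (Set.Icc l u) := by
  have hres : ν.restrict (Set.Icc l u) = ν :=
    Measure.restrict_eq_self_of_ae_mem (measure_eq_zero_iff_ae_notMem.1 hν |>.mono
      fun x hx => by simpa using hx)
  rw [← hres]
  refine Measure.restrict_mono le_rfl (le_volume_of_Ioc_le fun a b => ?_)
  have hsub : Set.Ioc a b ∩ Set.Icc l u ⊆ Set.Icc (max a l) (min b u) := fun x hx =>
    ⟨max_le hx.1.1.le hx.2.1, le_min hx.1.2 hx.2.2⟩
  rw [← hres, Measure.restrict_apply measurableSet_Ioc]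
  rcases le_or_gt (max a l) (min b u) with hle | hlt
  · refine (measure_mono hsub).trans ((h _ _ (le_max_right _ _) hle (min_le_right _ _)).trans ?_)
    exact ENNReal.ofReal_le_ofReal (sub_le_sub (min_le_left _ _) (le_max_left _ _))
  · rw [Set.Icc_eq_empty hlt.not_ge] at hsub
    rw [Set.subset_empty_iff.1 hsub, measure_empty]
    exact zero_le

theorem queenons_measure_isOpen_le {γ : ProbabilityMeasure (ℝ × ℝ)} (hγ : γ ∈ queenons)
    {U : Set (ℝ × ℝ)} (hU : IsOpen U) {c : ℝ≥0∞}
    (h : ∀ μ : ProbabilityMeasure (ℝ × ℝ), IsStepPermuton μ.toMeasure →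
      SubUniformDiag μ.toMeasure → μ.toMeasure U ≤ c) :
    γ.toMeasure U ≤ c := by
  have : NeBot (𝓝[_] γ) := mem_closure_iff_nhdsWithin_neBot.1 hγ
  refine (ProbabilityMeasure.le_liminf_measure_open_of_tendsto
    (L := 𝓝[{μ : ProbabilityMeasure (ℝ × ℝ) |
      IsStepPermuton μ.toMeasure ∧ SubUniformDiag μ.toMeasure}] γ)
    (μs := id) (tendsto_id.mono_left nhdsWithin_le_nhds) hU).trans ?_
  refine liminf_le_of_frequently_le' (Eventually.frequently ?_)
  filter_upwards [self_mem_nhdsWithin] with μ hμ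
  exact h μ hμ.1 hμ.2

theorem isClosed_unitSq : IsClosed unitSq := isClosed_Icc.prod isClosed_Icc

theorem queenons_measure_compl_unitSq {γ : ProbabilityMeasure (ℝ × ℝ)} (hγ : γ ∈ queenons) :
    γ.toMeasure unitSqᶜ = 0 := by
  refine nonpos_iff_eq_zero.1 (queenons_measure_isOpen_le hγ isClosed_unitSq.isOpen_compl ?_)
  rintro μ ⟨n, -, hμ, -⟩ -
  exact hμ.2.1.le

theorem map_compl_Icc_eq_zero {μ : Measure (ℝ × ℝ)} (hμ : μ unitSqᶜ = 0) {f : ℝ × ℝ → ℝ}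
    (hf : Measurable f) (hfs : ∀ p ∈ unitSq, f p ∈ Set.Icc (-1 : ℝ) 1) :
    μ.map f (Set.Icc (-1 : ℝ) 1)ᶜ = 0 := by
  rw [Measure.map_apply hf measurableSet_Icc.compl]
  exact measure_mono_null (fun p hp hpm => hp (hfs p hpm)) hμ

theorem add_mem_Icc_of_mem_unitSq {p : ℝ × ℝ} (hp : p ∈ unitSq) :
    p.1 + p.2 ∈ Set.Icc (-1 : ℝ) 1 := by
  obtain ⟨⟨h₁, h₂⟩, h₃, h₄⟩ := hp
  constructor <;> linarith

theorem sub_mem_Icc_of_mem_unitSq {p : ℝ × ℝ} (hp : p ∈ unitSq) :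
    p.1 - p.2 ∈ Set.Icc (-1 : ℝ) 1 := by
  obtain ⟨⟨h₁, h₂⟩, h₃, h₄⟩ := hp
  constructor <;> linarith

theorem sub_mem_Icc_of_mem_unitSq' {p : ℝ × ℝ} (hp : p ∈ unitSq) :
    p.2 - p.1 ∈ Set.Icc (-1 : ℝ) 1 := by
  obtain ⟨⟨h₁, h₂⟩, h₃, h₄⟩ := hp
  constructor <;> linarith

/-- A bound on the strips of step permutons passes to queenons. -/
theorem queenons_map_le {γ : ProbabilityMeasure (ℝ × ℝ)} (hγ : γ ∈ queenons)
    {f : ℝ × ℝ → ℝ} (hf : Continuous f) (hfs : ∀ p ∈ unitSq, f p ∈ Set.Icc (-1 : ℝ) 1)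
    (h : ∀ μ : ProbabilityMeasure (ℝ × ℝ), SubUniformDiag μ.toMeasure →
      ∀ a b : ℝ, -1 ≤ a → a ≤ b → b ≤ 1 →
        μ.toMeasure {p ∈ unitSq | a ≤ f p ∧ f p ≤ b} ≤ ENNReal.ofReal (b - a)) :
    γ.toMeasure.map f ≤ volume.restrict (Set.Icc (-1 : ℝ) 1) := by
  refine le_volume_restrict_of_Icc_le
    (map_compl_Icc_eq_zero (queenons_measure_compl_unitSq hγ) hf.measurable hfs) ?_
  intro a b ha hab hb
  rw [Measure.map_apply hf.measurable measurableSet_Icc]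
  have hε : ∀ ε : ℝ, 0 < ε →
      γ.toMeasure (f ⁻¹' Set.Icc a b) ≤ ENNReal.ofReal (b - a + 2 * ε) := by
    intro ε hε
    refine (measure_mono (Set.preimage_mono (t := Set.Ioo (a - ε) (b + ε)) ?_)).trans
      (queenons_measure_isOpen_le hγ (isOpen_Ioo.preimage hf) ?_)
    · exact Set.Icc_subset_Ioo (by linarith) (by linarith)
    · rintro μ ⟨n, -, hμ, -⟩ hsub
      have hle := h μ hsub (max (a - ε) (-1)) (min (b + ε) 1) (le_max_right _ _)
        (by simp only [max_le_iff, le_min_iff]; refine ⟨⟨?_, ?_⟩, ?_, ?_⟩ <;> linarith)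
        (min_le_right _ _)
      have hcover : f ⁻¹' Set.Ioo (a - ε) (b + ε) ⊆
          {p ∈ unitSq | max (a - ε) (-1) ≤ f p ∧ f p ≤ min (b + ε) 1} ∪ unitSqᶜ := by
        intro p hp
        by_cases hpm : p ∈ unitSq
        · exact Or.inl ⟨hpm, max_le hp.1.le (hfs p hpm).1, le_min hp.2.le (hfs p hpm).2⟩
        · exact Or.inr hpm
      refine (measure_mono hcover).trans ((measure_union_le _ _).trans ?_)
      rw [hμ.2.1, add_zero]
      refine hle.trans (ENNReal.ofReal_le_ofReal ?_)
      linarith [le_max_left (a - ε) (-1), min_le_left (b + ε) 1]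
  have htend : Tendsto (fun ε : ℝ => ENNReal.ofReal (b - a + 2 * ε)) (𝓝[>] 0)
      (𝓝 (ENNReal.ofReal (b - a))) := by
    have hc : Continuous fun ε : ℝ => ENNReal.ofReal (b - a + 2 * ε) :=
      ENNReal.continuous_ofReal.comp (by fun_prop)
    simpa using (hc.tendsto 0).mono_left nhdsWithin_le_nhds
  exact ge_of_tendsto htend (eventually_nhdsWithin_of_forall hε)

theorem diagPlus_le {γ : ProbabilityMeasure (ℝ × ℝ)} (hγ : γ ∈ queenons) :
    diagPlus γ.toMeasure ≤ volume.restrict (Set.Icc (-1 : ℝ) 1) :=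
  queenons_map_le hγ (by fun_prop) (fun _ => add_mem_Icc_of_mem_unitSq)
    fun _ hμ a b ha hab hb => (hμ a b ha hab hb).1

theorem diagMinus_le {γ : ProbabilityMeasure (ℝ × ℝ)} (hγ : γ ∈ queenons) :
    diagMinus γ.toMeasure ≤ volume.restrict (Set.Icc (-1 : ℝ) 1) :=
  queenons_map_le hγ (by fun_prop) (fun _ => sub_mem_Icc_of_mem_unitSq')
    fun _ hμ a b ha hab hb => (hμ a b ha hab hb).2

/-- Finite measures whose diagonal marginals are dominated by half of Lebesgue measure on
`[-1,1]`. -/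
structure HalfSubUniform (μ : Measure (ℝ × ℝ)) : Prop where
  finite : IsFiniteMeasure μ
  plus : μ.map (fun p => p.1 + p.2) ≤ unif11
  minus : μ.map (fun p => p.1 - p.2) ≤ unif11

theorem measure_smul_mono {α : Type*} [MeasurableSpace α] {μ ν : Measure α} (h : μ ≤ ν)
    (c : ℝ≥0∞) : c • μ ≤ c • ν := by
  gcongr

theorem map_le_unif11 {μ : Measure (ℝ × ℝ)} (hμ : μ unitSqᶜ = 0) {f : ℝ × ℝ → ℝ}
    (hf : Measurable f) (hfs : ∀ p ∈ unitSq, f p ∈ Set.Icc (-1 : ℝ) 1)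
    (h : ∀ a b : ℝ, -1 ≤ a → a ≤ b → b ≤ 1 →
      μ {p | a ≤ f p ∧ f p ≤ b} ≤ ENNReal.ofReal ((b - a) / 2)) :
    μ.map f ≤ unif11 := by
  have hle : (2 : ℝ≥0∞) • μ.map f ≤ volume.restrict (Set.Icc (-1 : ℝ) 1) := by
    refine le_volume_restrict_of_Icc_le ?_ fun a b ha hab hb => ?_
    · rw [Measure.smul_apply, map_compl_Icc_eq_zero hμ hf hfs, smul_zero]
    · rw [Measure.smul_apply, Measure.map_apply hf measurableSet_Icc, smul_eq_mul]
      calc 2 * μ (f ⁻¹' Set.Icc a b) ≤ ENNReal.ofReal 2 * ENNReal.ofReal ((b - a) / 2) := by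
            rw [ENNReal.ofReal_ofNat]
            exact mul_le_mul_right (h a b ha hab hb) 2
        _ = ENNReal.ofReal (b - a) := by
            rw [← ENNReal.ofReal_mul zero_le_two]
            congr 1
            ring
  have hhalf : μ.map f = (2 : ℝ≥0∞)⁻¹ • (2 : ℝ≥0∞) • μ.map f := by
    rw [smul_smul, ENNReal.inv_mul_cancel two_ne_zero ENNReal.ofNat_ne_top, one_smul]
  rw [hhalf, unif11]
  exact measure_smul_mono hle _

theorem IsBWDecomp.symm {γ γb γw : Measure (ℝ × ℝ)} (h : IsBWDecomp γ γb γw) :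
    IsBWDecomp γ γw γb :=
  ⟨(add_comm _ _).trans h.1, fun a b ha hab hb => (h.2 a b ha hab hb).symm⟩

theorem IsBWDecomp.halfSubUniform {γ : ProbabilityMeasure (ℝ × ℝ)} (hγ : γ ∈ queenons)
    {γb γw : Measure (ℝ × ℝ)} (h : IsBWDecomp γ.toMeasure γb γw) : HalfSubUniform γb := by
  have hle : γb ≤ γ.toMeasure := h.1 ▸ Measure.le_add_right le_rfl
  have hsupp : γb unitSqᶜ = 0 :=
    nonpos_iff_eq_zero.1 ((hle _).trans (queenons_measure_compl_unitSq hγ).le)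
  exact
    { finite := isFiniteMeasure_of_le _ hle
      plus := map_le_unif11 hsupp (by fun_prop) (fun _ => add_mem_Icc_of_mem_unitSq)
        fun a b ha hab hb => (h.2 a b ha hab hb).1.1
      minus := map_le_unif11 hsupp (by fun_prop) (fun _ => sub_mem_Icc_of_mem_unitSq)
        fun a b ha hab hb => (h.2 a b ha hab hb).1.2 }

theorem ofReal_add_ofReal_one_sub {t : ℝ} (h₀ : 0 ≤ t) (h₁ : t ≤ 1) :
    ENNReal.ofReal t + ENNReal.ofReal (1 - t) = 1 := by
  rw [← ENNReal.ofReal_add h₀ (sub_nonneg.2 h₁), add_sub_cancel, ENNReal.ofReal_one]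

theorem map_convexComb_le {α β : Type*} [MeasurableSpace α] [MeasurableSpace β]
    {μ ν : Measure α} {ρ : Measure β} {f : α → β} (hf : Measurable f) (hμ : μ.map f ≤ ρ)
    (hν : ν.map f ≤ ρ) {t : ℝ} (h₀ : 0 ≤ t) (h₁ : t ≤ 1) :
    (ENNReal.ofReal t • μ + ENNReal.ofReal (1 - t) • ν).map f ≤ ρ := by
  rw [Measure.map_add _ _ hf, Measure.map_smul, Measure.map_smul]
  calc _ ≤ ENNReal.ofReal t • ρ + ENNReal.ofReal (1 - t) • ρ :=
        add_le_add (measure_smul_mono hμ _) (measure_smul_mono hν _)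
    _ = ρ := by rw [← add_smul, ofReal_add_ofReal_one_sub h₀ h₁, one_smul]

theorem HalfSubUniform.convexComb {μ ν : Measure (ℝ × ℝ)} (hμ : HalfSubUniform μ)
    (hν : HalfSubUniform ν) {t : ℝ} (h₀ : 0 ≤ t) (h₁ : t ≤ 1) :
    HalfSubUniform (ENNReal.ofReal t • μ + ENNReal.ofReal (1 - t) • ν) where
  finite := by
    have := hμ.finite
    have := hν.finite
    have := Measure.smul_finite μ (ENNReal.ofReal_ne_top (r := t))
    have := Measure.smul_finite ν (ENNReal.ofReal_ne_top (r := 1 - t))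
    infer_instance
  plus := map_convexComb_le (by fun_prop) hμ.plus hν.plus h₀ h₁
  minus := map_convexComb_le (by fun_prop) hμ.minus hν.minus h₀ h₁

theorem toReal_sub_map_apply {ρ : Measure ℝ} [IsFiniteMeasure ρ] {μ : Measure (ℝ × ℝ)}
    [IsFiniteMeasure μ] {f : ℝ × ℝ → ℝ} (hf : Measurable f) (h : μ.map f ≤ ρ) {s : Set ℝ}
    (hs : MeasurableSet s) :
    ((ρ - μ.map f) s).toReal = (ρ s).toReal - (μ (f ⁻¹' s)).toReal := by
  rw [Measure.sub_apply hs h, ENNReal.toReal_sub_of_le (h s) (measure_ne_top _ _),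
    Measure.map_apply hf hs]

theorem measurableSet_JNcell (N i : ℕ) : MeasurableSet (JNcell N i) := measurableSet_Icc

instance : IsFiniteMeasure unif11 :=
  Measure.smul_finite _ (ENNReal.inv_ne_top.2 two_ne_zero)

theorem HalfSubUniform.toReal_bwBarPlus {μ : Measure (ℝ × ℝ)} (hμ : HalfSubUniform μ)
    (N i : ℕ) : (bwBarPlus μ (JNcell N i)).toReal = (unif11 (JNcell N i)).toReal -
      (μ ((fun p => p.1 + p.2) ⁻¹' JNcell N i)).toReal :=
  have := hμ.finite
  toReal_sub_map_apply (by fun_prop) hμ.plus (measurableSet_JNcell N i)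

theorem HalfSubUniform.toReal_bwBarMinus {μ : Measure (ℝ × ℝ)} (hμ : HalfSubUniform μ)
    (N i : ℕ) : (bwBarMinus μ (JNcell N i)).toReal = (unif11 (JNcell N i)).toReal -
      (μ ((fun p => p.1 - p.2) ⁻¹' JNcell N i)).toReal :=
  have := hμ.finite
  toReal_sub_map_apply (by fun_prop) hμ.minus (measurableSet_JNcell N i)

theorem toReal_convexComb_apply {α : Type*} [MeasurableSpace α] (μ ν : Measure α)
    [IsFiniteMeasure μ] [IsFiniteMeasure ν] {t : ℝ} (h₀ : 0 ≤ t) (h₁ : t ≤ 1) (s : Set α) :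
    ((ENNReal.ofReal t • μ + ENNReal.ofReal (1 - t) • ν) s).toReal =
      t * (μ s).toReal + (1 - t) * (ν s).toReal := by
  rw [Measure.add_apply, Measure.smul_apply, Measure.smul_apply, smul_eq_mul, smul_eq_mul,
    ENNReal.toReal_add (by finiteness) (by finiteness), ENNReal.toReal_mul, ENNReal.toReal_mul,
    ENNReal.toReal_ofReal h₀, ENNReal.toReal_ofReal (sub_nonneg.2 h₁)]

theorem HalfSubUniform.toReal_bwBarPlus_convexComb {μ ν : Measure (ℝ × ℝ)}
    (hμ : HalfSubUniform μ) (hν : HalfSubUniform ν) {t : ℝ} (h₀ : 0 ≤ t) (h₁ : t ≤ 1)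
    (N i : ℕ) :
    (bwBarPlus (ENNReal.ofReal t • μ + ENNReal.ofReal (1 - t) • ν) (JNcell N i)).toReal =
      t * (bwBarPlus μ (JNcell N i)).toReal +
        (1 - t) * (bwBarPlus ν (JNcell N i)).toReal := by
  have := hμ.finite
  have := hν.finite
  rw [(hμ.convexComb hν h₀ h₁).toReal_bwBarPlus, hμ.toReal_bwBarPlus, hν.toReal_bwBarPlus,
    toReal_convexComb_apply _ _ h₀ h₁]
  ring

theorem HalfSubUniform.toReal_bwBarMinus_convexComb {μ ν : Measure (ℝ × ℝ)}
    (hμ : HalfSubUniform μ) (hν : HalfSubUniform ν) {t : ℝ} (h₀ : 0 ≤ t) (h₁ : t ≤ 1)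
    (N i : ℕ) :
    (bwBarMinus (ENNReal.ofReal t • μ + ENNReal.ofReal (1 - t) • ν) (JNcell N i)).toReal =
      t * (bwBarMinus μ (JNcell N i)).toReal +
        (1 - t) * (bwBarMinus ν (JNcell N i)).toReal := by
  have := hμ.finite
  have := hν.finite
  rw [(hμ.convexComb hν h₀ h₁).toReal_bwBarMinus, hμ.toReal_bwBarMinus, hν.toReal_bwBarMinus,
    toReal_convexComb_apply _ _ h₀ h₁]
  ring

theorem mul_log_const_mul_convex {c x y t : ℝ} (hx : 0 ≤ x) (hy : 0 ≤ y)
    (h₀ : 0 ≤ t) (h₁ : t ≤ 1) :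
    (t * x + (1 - t) * y) * Real.log (c * (t * x + (1 - t) * y)) ≤
      t * (x * Real.log (c * x)) + (1 - t) * (y * Real.log (c * y)) := by
  rcases eq_or_ne c 0 with rfl | hc
  · simp
  have hexp : ∀ z : ℝ, z * Real.log (c * z) = z * Real.log c + z * Real.log z := by
    intro z
    rcases eq_or_ne z 0 with rfl | hz
    · simp
    · rw [Real.log_mul hc hz, mul_add]
  have hconv := Real.convexOn_mul_log.2 hx hy h₀ (sub_nonneg.2 h₁) (add_sub_cancel t 1)
  simp only [smul_eq_mul] at hconv
  rw [hexp, hexp, hexp]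
  linarith

theorem sum_mul_log_convex {ι : Type*} (s : Finset ι) (c : ι → ℝ) {x y x' y' z w : ι → ℝ}
    {t : ℝ} (h₀ : 0 ≤ t) (h₁ : t ≤ 1) (hx : ∀ i, 0 ≤ x i) (hy : ∀ i, 0 ≤ y i)
    (hx' : ∀ i, 0 ≤ x' i) (hy' : ∀ i, 0 ≤ y' i)
    (hz : ∀ i, z i = t * x i + (1 - t) * x' i) (hw : ∀ i, w i = t * y i + (1 - t) * y' i) :
    ∑ i ∈ s, (z i * Real.log (c i * z i) + w i * Real.log (c i * w i)) ≤
      t * ∑ i ∈ s, (x i * Real.log (c i * x i) + y i * Real.log (c i * y i)) +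
        (1 - t) * ∑ i ∈ s, (x' i * Real.log (c i * x' i) + y' i * Real.log (c i * y' i)) := by
  rw [Finset.mul_sum, Finset.mul_sum, ← Finset.sum_add_distrib]
  refine Finset.sum_le_sum fun i _ => ?_
  rw [hz, hw]
  linarith [mul_log_const_mul_convex (c := c i) (hx i) (hx' i) h₀ h₁,
    mul_log_const_mul_convex (c := c i) (hy i) (hy' i) h₀ h₁]

theorem GN_convexComb_le (N : ℕ) {γb γw δb δw : Measure (ℝ × ℝ)}
    (hγb : HalfSubUniform γb) (hγw : HalfSubUniform γw) (hδb : HalfSubUniform δb)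
    (hδw : HalfSubUniform δw) {t : ℝ} (h₀ : 0 ≤ t) (h₁ : t ≤ 1) :
    t * GN N γb γw + (1 - t) * GN N δb δw ≤
      GN N (ENNReal.ofReal t • γb + ENNReal.ofReal (1 - t) • δb)
        (ENNReal.ofReal t • γw + ENNReal.ofReal (1 - t) • δw) := by
  have := hγb.finite
  have := hγw.finite
  have := hδb.finite
  have := hδw.finite
  have hcell := sum_mul_log_convex (Finset.Icc 1 (2 * N) ×ˢ Finset.Icc 1 (2 * N))
    (fun ij => 2 / (volume (INcell N ij.1 ij.2)).toReal) h₀ h₁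
    (fun _ => ENNReal.toReal_nonneg) (fun _ => ENNReal.toReal_nonneg)
    (fun _ => ENNReal.toReal_nonneg) (fun _ => ENNReal.toReal_nonneg)
    (fun ij => toReal_convexComb_apply γb δb h₀ h₁ (INcell N ij.1 ij.2))
    (fun ij => toReal_convexComb_apply γw δw h₀ h₁ (INcell N ij.1 ij.2))
  have hplus := sum_mul_log_convex (Finset.Icc 1 (2 * N)) (fun _ => (4 * N : ℝ)) h₀ h₁
    (fun _ => ENNReal.toReal_nonneg) (fun _ => ENNReal.toReal_nonneg)
    (fun _ => ENNReal.toReal_nonneg) (fun _ => ENNReal.toReal_nonneg)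
    (hγb.toReal_bwBarPlus_convexComb hδb h₀ h₁ N) (hγw.toReal_bwBarPlus_convexComb hδw h₀ h₁ N)
  have hminus := sum_mul_log_convex (Finset.Icc 1 (2 * N)) (fun _ => (4 * N : ℝ)) h₀ h₁
    (fun _ => ENNReal.toReal_nonneg) (fun _ => ENNReal.toReal_nonneg)
    (fun _ => ENNReal.toReal_nonneg) (fun _ => ENNReal.toReal_nonneg)
    (hγb.toReal_bwBarMinus_convexComb hδb h₀ h₁ N)
    (hγw.toReal_bwBarMinus_convexComb hδw h₀ h₁ N)
  simp only [Finset.sum_product, div_mul_eq_mul_div] at hcell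
  unfold GN
  linarith

theorem GN_comm (N : ℕ) (γb γw : Measure (ℝ × ℝ)) : GN N γb γw = GN N γw γb := by
  unfold GN
  simp only [add_comm]

theorem JNcell_neg {N i : ℕ} (hi : i ∈ Finset.Icc 1 (2 * N)) (x : ℝ) :
    -x ∈ JNcell N (2 * N + 1 - i) ↔ x ∈ JNcell N i := by
  rw [Finset.mem_Icc] at hi
  have hN : (N : ℝ) ≠ 0 := by
    have : N ≠ 0 := by omega
    exact_mod_cast this
  have hcast : ((2 * N + 1 - i : ℕ) : ℝ) = 2 * N + 1 - i := by
    rw [Nat.cast_sub (by omega)]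
    push_cast
    ring
  have h₁ : (-1 : ℝ) + (((2 * N + 1 - i : ℕ) : ℝ) - 1) / N = -(-1 + (i : ℝ) / N) := by
    rw [hcast]
    field_simp
    ring
  have h₂ : (-1 : ℝ) + ((2 * N + 1 - i : ℕ) : ℝ) / N = -(-1 + ((i : ℝ) - 1) / N) := by
    rw [hcast]
    field_simp
    ring
  rw [JNcell, JNcell, h₁, h₂, Set.mem_Icc, Set.mem_Icc, neg_le_neg_iff, neg_le_neg_iff, and_comm]

theorem sum_Icc_reflect {M : Type*} [AddCommMonoid M] (f : ℕ → M) (n : ℕ) :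
    ∑ i ∈ Finset.Icc 1 n, f (n + 1 - i) = ∑ i ∈ Finset.Icc 1 n, f i := by
  refine Finset.sum_nbij' (fun i => n + 1 - i) (fun i => n + 1 - i) ?_ ?_ ?_ ?_ ?_ <;>
    intro i hi <;> simp only [Finset.mem_Icc] at * <;> omega

theorem volume_restrict_JNcell {N i : ℕ} (hi : i ∈ Finset.Icc 1 (2 * N)) :
    (volume.restrict (Set.Icc (-1 : ℝ) 1) (JNcell N (2 * N + 1 - i))) =
      volume.restrict (Set.Icc (-1 : ℝ) 1) (JNcell N i) := by
  rw [Measure.restrict_apply (measurableSet_JNcell _ _),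
    Measure.restrict_apply (measurableSet_JNcell _ _), ← Measure.measure_neg]
  congr 1
  ext x
  simp only [Set.mem_neg, Set.mem_inter_iff, JNcell_neg hi, Set.mem_Icc]
  constructor <;> rintro ⟨h, h₁, h₂⟩ <;> exact ⟨h, by linarith, by linarith⟩

theorem toReal_inv_two_smul {α : Type*} [MeasurableSpace α] (μ : Measure α) (s : Set α) :
    (((2 : ℝ≥0∞)⁻¹ • μ) s).toReal = (μ s).toReal / 2 := by
  rw [Measure.smul_apply, smul_eq_mul, ENNReal.toReal_mul, ENNReal.toReal_inv,
    ENNReal.toReal_ofNat, inv_mul_eq_div]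

theorem preimage_sub_JNcell {N i : ℕ} (hi : i ∈ Finset.Icc 1 (2 * N)) :
    (fun p : ℝ × ℝ => p.2 - p.1) ⁻¹' JNcell N (2 * N + 1 - i) =
      (fun p : ℝ × ℝ => p.1 - p.2) ⁻¹' JNcell N i := by
  ext p
  simp only [Set.mem_preimage]
  rw [← neg_sub, JNcell_neg hi]

theorem halfSubUniform_inv_two_smul {γ : ProbabilityMeasure (ℝ × ℝ)} (hγ : γ ∈ queenons) :
    HalfSubUniform ((2 : ℝ≥0∞)⁻¹ • γ.toMeasure) where
  finite := Measure.smul_finite _ (ENNReal.inv_ne_top.2 two_ne_zero)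
  plus := by
    rw [Measure.map_smul, unif11]
    exact measure_smul_mono (diagPlus_le hγ) _
  minus := by
    rw [Measure.map_smul, unif11]
    exact measure_smul_mono (queenons_map_le hγ (by fun_prop)
      (fun _ => sub_mem_Icc_of_mem_unitSq) fun μ hμ a b ha hab hb => by
        have := (hμ (-b) (-a) (by linarith) (by linarith) (by linarith)).2
        rw [neg_sub_neg] at this
        refine le_trans (measure_mono ?_) this
        rintro p ⟨hp, h₁, h₂⟩
        exact ⟨hp, by linarith, by linarith⟩) _

theorem toReal_bwBarPlus_inv_two_smul {γ : ProbabilityMeasure (ℝ × ℝ)} (hγ : γ ∈ queenons)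
    (N i : ℕ) : (bwBarPlus ((2 : ℝ≥0∞)⁻¹ • γ.toMeasure) (JNcell N i)).toReal =
      (barPlus γ.toMeasure (JNcell N i)).toReal / 2 := by
  rw [(halfSubUniform_inv_two_smul hγ).toReal_bwBarPlus, barPlus, diagPlus,
    toReal_sub_map_apply (by fun_prop) (diagPlus_le hγ) (measurableSet_JNcell N i), unif11,
    toReal_inv_two_smul, toReal_inv_two_smul, sub_div]

theorem toReal_bwBarMinus_inv_two_smul {γ : ProbabilityMeasure (ℝ × ℝ)} (hγ : γ ∈ queenons)
    {N i : ℕ} (hi : i ∈ Finset.Icc 1 (2 * N)) :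
    (bwBarMinus ((2 : ℝ≥0∞)⁻¹ • γ.toMeasure) (JNcell N i)).toReal =
      (barMinus γ.toMeasure (JNcell N (2 * N + 1 - i))).toReal / 2 := by
  rw [(halfSubUniform_inv_two_smul hγ).toReal_bwBarMinus, barMinus, diagMinus,
    toReal_sub_map_apply (by fun_prop) (diagMinus_le hγ) (measurableSet_JNcell N _), unif11,
    toReal_inv_two_smul, toReal_inv_two_smul, preimage_sub_JNcell hi,
    volume_restrict_JNcell hi, sub_div]

theorem GN_inv_two_smul {γ : ProbabilityMeasure (ℝ × ℝ)} (hγ : γ ∈ queenons) (N : ℕ) :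
    GN N ((2 : ℝ≥0∞)⁻¹ • γ.toMeasure) ((2 : ℝ≥0∞)⁻¹ • γ.toMeasure) = HqN N γ.toMeasure := by
  have hterm : ∀ x : ℝ, x / 2 * Real.log (4 * N * (x / 2)) + x / 2 * Real.log (4 * N * (x / 2)) =
      x * Real.log (2 * N * x) := by
    intro x
    rw [← add_mul, add_halves]
    ring_nf
  have hminus : ∑ i ∈ Finset.Icc 1 (2 * N),
      ((bwBarMinus ((2 : ℝ≥0∞)⁻¹ • γ.toMeasure) (JNcell N i)).toReal *
          Real.log (4 * N * (bwBarMinus ((2 : ℝ≥0∞)⁻¹ • γ.toMeasure) (JNcell N i)).toReal) +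
        (bwBarMinus ((2 : ℝ≥0∞)⁻¹ • γ.toMeasure) (JNcell N i)).toReal *
          Real.log (4 * N * (bwBarMinus ((2 : ℝ≥0∞)⁻¹ • γ.toMeasure) (JNcell N i)).toReal)) =
      ∑ i ∈ Finset.Icc 1 (2 * N), (barMinus γ.toMeasure (JNcell N i)).toReal *
        Real.log (2 * N * (barMinus γ.toMeasure (JNcell N i)).toReal) := by
    rw [← sum_Icc_reflect (fun i => (barMinus γ.toMeasure (JNcell N i)).toReal *
      Real.log (2 * N * (barMinus γ.toMeasure (JNcell N i)).toReal))]
    refine Finset.sum_congr rfl fun i hi => ?_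
    rw [toReal_bwBarMinus_inv_two_smul hγ hi, hterm]
  rw [GN, HqN, hminus]
  simp only [toReal_bwBarPlus_inv_two_smul hγ, hterm, toReal_inv_two_smul, ← add_mul, add_halves,
    mul_div_cancel₀ _ (two_ne_zero (α := ℝ))]

theorem IsBWDecomp.GN_le {γ : ProbabilityMeasure (ℝ × ℝ)} (hγ : γ ∈ queenons) (N : ℕ)
    {γb γw : Measure (ℝ × ℝ)} (h : IsBWDecomp γ.toMeasure γb γw) :
    GN N γb γw ≤ HqN N γ.toMeasure := by
  have hb := h.halfSubUniform hγ
  have hw := h.symm.halfSubUniform hγ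
  have hle := GN_convexComb_le N hb hw hw hb (t := 2⁻¹) (by norm_num) (by norm_num)
  have hofReal : ENNReal.ofReal 2⁻¹ = (2 : ℝ≥0∞)⁻¹ := by
    rw [ENNReal.ofReal_inv_of_pos two_pos, ENNReal.ofReal_ofNat]
  rw [show (1 : ℝ) - 2⁻¹ = 2⁻¹ by norm_num, hofReal, ← smul_add, ← smul_add, h.1, h.symm.1,
    GN_inv_two_smul hγ, GN_comm N γw γb] at hle
  linarith

/-- **Observation (properties of `G^N`).**
`G^N` is concave on the convex set `BW`; `G^N(γ/2, γ/2) = H_q^N(γ)`; and `G^N` is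
maximized on `BW(γ)` by `(γ/2, γ/2)`. -/
theorem GN_properties (γ : ProbabilityMeasure (ℝ × ℝ)) (hγ : γ ∈ queenons) (N : ℕ) :
    (∀ γb γw δb δw : Measure (ℝ × ℝ), memBW γb γw → memBW δb δw →
      ∀ t : ℝ, 0 ≤ t → t ≤ 1 →
        t * GN N γb γw + (1 - t) * GN N δb δw ≤
          GN N (ENNReal.ofReal t • γb + ENNReal.ofReal (1 - t) • δb)
            (ENNReal.ofReal t • γw + ENNReal.ofReal (1 - t) • δw)) ∧
    GN N ((2 : ℝ≥0∞)⁻¹ • γ.toMeasure) ((2 : ℝ≥0∞)⁻¹ • γ.toMeasure) = HqN N γ.toMeasure ∧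
    (∀ γb γw : Measure (ℝ × ℝ), IsBWDecomp γ.toMeasure γb γw →
      GN N γb γw ≤ HqN N γ.toMeasure) := by
  refine ⟨?_, GN_inv_two_smul hγ N, fun γb γw h => h.GN_le hγ N⟩
  rintro γb γw δb δw ⟨γ', hγ', hb⟩ ⟨δ', hδ', hd⟩ t h₀ h₁
  exact GN_convexComb_le N (hb.halfSubUniform hγ') (hb.symm.halfSubUniform hγ')
    (hd.halfSubUniform hδ') (hd.symm.halfSubUniform hδ') h₀ h₁

end
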